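/- arXiv:1702.05622 — 9 statements merged into one kernel-verified Lean document; each statement's English description precedes it below -/
import Mathlib

section
/- For any fixed q with q ≥ A, the function p ↦ f1(p,q) is monotonically nonincreasing on [0, ∞): if 0 ≤ p₁ ≤ p₂ then f1(p₂, q) ≤ f1(p₁, q). -/
/-- `f1(p,q) = hI/(ln 2·(σ²+p·hI)) − hE/(ln 2·(σ²+q·gE+p·hE)) − λ + β·hJ + μ·hE`. -/
noncomputable def f1 (σ2 hI hE gE hJ lam β μ p q : ℝ) : ℝ :=
  hI / (Real.log 2 * (σ2 + p * hI)) - hE / (Real.log 2 * (σ2 + q * gE + p * hE))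
    - lam + β * hJ + μ * hE

/-- If `a / x ≤ c / y`, then `p ↦ x / (L (a + p x)) - y / (L (c + p y))` is nonincreasing
on `[0, ∞)`. -/
theorem div_sub_div_antitone_of_mul_le {L a c x y p₁ p₂ : ℝ} (hL : 0 < L) (ha : 0 < a)
    (hc : 0 < c) (hx : 0 < x) (hy : 0 < y) (h : a * y ≤ c * x) (hp₁ : 0 ≤ p₁) (hp : p₁ ≤ p₂) :
    x / (L * (a + p₂ * x)) - y / (L * (c + p₂ * y)) ≤
      x / (L * (a + p₁ * x)) - y / (L * (c + p₁ * y)) := by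
  have combine : ∀ p : ℝ, 0 ≤ p → x / (L * (a + p * x)) - y / (L * (c + p * y)) =
      (c * x - a * y) / (L * (a + p * x) * (c + p * y)) := by
    intro p hp0
    have h₁ : a + p * x ≠ 0 := by positivity
    have h₂ : c + p * y ≠ 0 := by positivity
    field_simp
    ring
  have hp₂ : 0 ≤ p₂ := hp₁.trans hp
  rw [combine p₂ hp₂, combine p₁ hp₁]
  have hnum : 0 ≤ c * x - a * y := sub_nonneg.mpr h
  gcongr

/-- For fixed q ≥ A, p ↦ f1(p,q) is monotonically nonincreasing on [0,∞). -/
theorem stmt1 (σ2 hI hE gE hJ lam β μ q p₁ p₂ : ℝ)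
    (hσ : 0 < σ2) (hhI : 0 < hI) (hhE : 0 < hE) (hgE : 0 < gE) (hhJ : 0 < hJ)
    (hlam : 0 ≤ lam) (hβ : 0 ≤ β) (hμ : 0 ≤ μ)
    (hq : q ≥ max 0 (σ2 * (hE - hI) / (hI * gE)))
    (hp₁ : 0 ≤ p₁) (hp : p₁ ≤ p₂) :
    f1 σ2 hI hE gE hJ lam β μ p₂ q ≤ f1 σ2 hI hE gE hJ lam β μ p₁ q := by
  have hq₀ : 0 ≤ q := (le_max_left _ _).trans hq
  have hA : σ2 * (hE - hI) / (hI * gE) ≤ q := (le_max_right _ _).trans hq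
  rw [div_le_iff₀ (by positivity)] at hA
  have key := div_sub_div_antitone_of_mul_le (Real.log_pos one_lt_two) hσ
    (by positivity : 0 < σ2 + q * gE) hhI hhE (by linarith) hp₁ hp
  unfold f1
  linarith
end

section
/- Let p̄ > 0 be the peak power. For every q ≥ A and every p with 0 ≤ p ≤ p̄, one has f1(p̄, q) ≤ f1(p, q) ≤ f1(0, q), where A := max(0, σ²·(hE − hI)/(hI·gE)). -/
/-- If `σ2 / hI ≤ (σ2 + q * gE) / hE`, then `f1` is antitone in the power `p ≥ 0`. -/
theorem f1_le_f1_of_le {σ2 hI hE gE hJ lam β μ p₁ p₂ q : ℝ}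
    (hσ : 0 < σ2) (hhI : 0 < hI) (hhE : 0 < hE) (hc : 0 < σ2 + q * gE)
    (h : hE * σ2 ≤ hI * (σ2 + q * gE)) (h₁ : 0 ≤ p₁) (h₁₂ : p₁ ≤ p₂) :
    f1 σ2 hI hE gE hJ lam β μ p₂ q ≤ f1 σ2 hI hE gE hJ lam β μ p₁ q := by
  have hL : 0 < Real.log 2 := Real.log_pos one_lt_two
  have h₂ : 0 ≤ p₂ := h₁.trans h₁₂
  have hX {p : ℝ} (hp : 0 ≤ p) : 0 < σ2 + p * hI := by positivity
  have hY {p : ℝ} (hp : 0 ≤ p) : 0 < σ2 + q * gE + p * hE := by positivity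
  have hratio {p : ℝ} (hp : 0 ≤ p) : hE / (σ2 + q * gE + p * hE) ≤ hI / (σ2 + p * hI) := by
    rw [div_le_div_iff₀ (hY hp) (hX hp)]
    linarith
  have hprod := mul_le_mul (hratio h₁) (hratio h₂) (div_pos hhE (hY h₂)).le
    (div_pos hhI (hX h₁)).le
  have hdiff : f1 σ2 hI hE gE hJ lam β μ p₁ q - f1 σ2 hI hE gE hJ lam β μ p₂ q =
      (p₂ - p₁) / Real.log 2 * (hI / (σ2 + p₁ * hI) * (hI / (σ2 + p₂ * hI)) -
        hE / (σ2 + q * gE + p₁ * hE) * (hE / (σ2 + q * gE + p₂ * hE))) := by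
    have := (hX h₁).ne'
    have := (hX h₂).ne'
    have := (hY h₁).ne'
    have := (hY h₂).ne'
    unfold f1
    field_simp
    ring
  rw [← sub_nonneg, hdiff]
  exact mul_nonneg (div_nonneg (sub_nonneg.2 h₁₂) hL.le) (sub_nonneg.2 hprod)

/-- For peak power p̄ > 0, every q ≥ A and every 0 ≤ p ≤ p̄,
`f1(p̄,q) ≤ f1(p,q) ≤ f1(0,q)`, where A := max(0, σ²(hE−hI)/(hI·gE)). -/
theorem stmt3 (σ2 hI hE gE hJ lam β μ pbar p q : ℝ)
    (hσ : 0 < σ2) (hhI : 0 < hI) (hhE : 0 < hE) (hgE : 0 < gE) (hhJ : 0 < hJ)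
    (hlam : 0 ≤ lam) (hβ : 0 ≤ β) (hμ : 0 ≤ μ)
    (hpbar : 0 < pbar)
    (hq : q ≥ max 0 (σ2 * (hE - hI) / (hI * gE)))
    (hp0 : 0 ≤ p) (hp : p ≤ pbar) :
    f1 σ2 hI hE gE hJ lam β μ pbar q ≤ f1 σ2 hI hE gE hJ lam β μ p q ∧
    f1 σ2 hI hE gE hJ lam β μ p q ≤ f1 σ2 hI hE gE hJ lam β μ 0 q := by
  have hq0 : 0 ≤ q := (le_max_left _ _).trans hq
  have hqA := (le_max_right _ _).trans hq
  rw [div_le_iff₀ (mul_pos hhI hgE)] at hqA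
  have h : hE * σ2 ≤ hI * (σ2 + q * gE) := by linarith
  have hc : 0 < σ2 + q * gE := by positivity
  exact ⟨f1_le_f1_of_le hσ hhI hhE hc h hp0 hp, f1_le_f1_of_le hσ hhI hhE hc h le_rfl hp0⟩
end

section
/- For any fixed q ≥ A, the function p ↦ L(p, q) is concave on [0, ∞), where A := max(0, σ²·(hE − hI)/(hI·gE)). -/
/-- Per-subcarrier Lagrangian
`L(p,q) = log₂(1+p·hI/σ²) − log₂(1+p·hE/(σ²+q·gE)) − λ·p + β·(p·hJ−q) + μ·(p·hE+q·gE)`. -/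
noncomputable def L (σ2 hI hE gE hJ lam β μ p q : ℝ) : ℝ :=
  Real.logb 2 (1 + p * hI / σ2) - Real.logb 2 (1 + p * hE / (σ2 + q * gE))
    - lam * p + β * (p * hJ - q) + μ * (p * hE + q * gE)

theorem hasDerivAt_log_one_add_mul_sub_log_one_add_mul {a b p : ℝ} (ha : 0 ≤ a) (hb : 0 ≤ b)
    (hp : 0 ≤ p) :
    HasDerivAt (fun p => Real.log (1 + a * p) - Real.log (1 + b * p))
      ((a - b) / ((1 + a * p) * (1 + b * p))) p := by
  have hlog (c : ℝ) (hc : 0 ≤ c) :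
      HasDerivAt (fun p => Real.log (1 + c * p)) (c / (1 + c * p)) p := by
    have h := ((hasDerivAt_id p).const_mul c).const_add 1
    simpa using h.log (by simp only [id]; positivity)
  refine ((hlog a ha).sub (hlog b hb)).congr_deriv ?_
  have h1 : 1 + a * p ≠ 0 := by positivity
  have h2 : 1 + b * p ≠ 0 := by positivity
  field_simp
  ring

theorem concaveOn_log_one_add_mul_sub_log_one_add_mul {a b : ℝ} (hb : 0 ≤ b) (hba : b ≤ a) :
    ConcaveOn ℝ (Set.Ici (0 : ℝ)) (fun p => Real.log (1 + a * p) - Real.log (1 + b * p)) := by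
  have ha : 0 ≤ a := hb.trans hba
  have hderiv {p : ℝ} (hp : 0 ≤ p) :=
    hasDerivAt_log_one_add_mul_sub_log_one_add_mul ha hb hp
  refine AntitoneOn.concaveOn_of_deriv (convex_Ici 0)
    (fun p hp => (hderiv hp).continuousAt.continuousWithinAt)
    (fun p hp => (hderiv (interior_subset hp)).differentiableAt.differentiableWithinAt) ?_
  intro x hx y hy hxy
  have hx0 : 0 ≤ x := interior_subset hx
  have hy0 : 0 ≤ y := interior_subset hy
  rw [(hderiv hx0).deriv, (hderiv hy0).deriv]
  have hab : 0 ≤ a - b := sub_nonneg.2 hba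
  gcongr

/-- For fixed q ≥ A = max(0, σ²(hE−hI)/(hI·gE)),
p ↦ L(p,q) is concave on [0,∞). -/
theorem stmt9 (σ2 hI hE gE hJ lam β μ q : ℝ)
    (hσ : 0 < σ2) (hhI : 0 < hI) (hhE : 0 < hE) (hgE : 0 < gE) (hhJ : 0 < hJ)
    (hlam : 0 ≤ lam) (hβ : 0 ≤ β) (hμ : 0 ≤ μ)
    (hq : q ≥ max 0 (σ2 * (hE - hI) / (hI * gE))) :
    ConcaveOn ℝ (Set.Ici (0 : ℝ)) (fun p => L σ2 hI hE gE hJ lam β μ p q) := by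
  obtain ⟨hq0, hqA⟩ := max_le_iff.1 hq
  have hden : 0 < σ2 + q * gE := by positivity
  have hba : hE / (σ2 + q * gE) ≤ hI / σ2 := by
    rw [div_le_iff₀ (by positivity)] at hqA
    rw [div_le_div_iff₀ hden hσ]
    linarith
  have hlog := (concaveOn_log_one_add_mul_sub_log_one_add_mul
    (div_nonneg hhE.le hden.le) hba).smul (inv_nonneg.2 (Real.log_nonneg one_le_two))
  have hlin : ConcaveOn ℝ (Set.Ici (0 : ℝ)) fun p => (-lam + β * hJ + μ * hE) * p :=
    (LinearMap.mulLeft ℝ (-lam + β * hJ + μ * hE)).concaveOn (convex_Ici 0)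
  refine ((hlog.add hlin).add_const (-β * q + μ * (q * gE))).congr fun p _ => ?_
  simp only [L, Real.logb, Pi.add_apply, smul_eq_mul, div_mul_eq_mul_div, mul_comm p hI,
    mul_comm p hE]
  ring
end

section
/- For any fixed p ≥ 0, the function q ↦ L(p, q) is concave on [0, ∞). -/
/-- For `c ≥ 0`, the function `x ↦ log (1 + c / x)` is convex on the positive reals. -/
theorem convexOn_log_one_add_div {c : ℝ} (hc : 0 ≤ c) :
    ConvexOn ℝ (Set.Ioi (0 : ℝ)) (fun x => Real.log (1 + c / x)) := by
  have hd : ∀ x ∈ Set.Ioi (0 : ℝ),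
      HasDerivAt (fun x => Real.log (x + c) - Real.log x) (1 / (x + c) - 1 / x) x := by
    intro x (hx : 0 < x)
    exact (((hasDerivAt_id x).add_const c).log (by simp only [id]; positivity)).sub
      ((hasDerivAt_id x).log hx.ne')
  have hconv : ConvexOn ℝ (Set.Ioi (0 : ℝ)) (fun x => Real.log (x + c) - Real.log x) := by
    refine MonotoneOn.convexOn_of_deriv (convex_Ioi 0)
      (fun x hx => (hd x hx).continuousAt.continuousWithinAt) ?_ ?_
    · rw [interior_Ioi]
      exact fun x hx => (hd x hx).differentiableAt.differentiableWithinAt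
    · rw [interior_Ioi]
      intro x hx y hy hxy
      rw [(hd x hx).deriv, (hd y hy).deriv]
      rw [Set.mem_Ioi] at hx hy
      have key : ∀ z : ℝ, 0 < z → 1 / (z + c) - 1 / z = -(c / (z * (z + c))) := by
        intro z hz
        have : z + c ≠ 0 := by positivity
        field_simp
        ring
      rw [key x hx, key y hy]
      gcongr
  refine hconv.congr fun x hx => ?_
  rw [Set.mem_Ioi] at hx
  beta_reduce
  rw [← Real.log_div (by positivity) hx.ne', add_div, div_self hx.ne']

/-- For fixed p ≥ 0, q ↦ L(p,q) is concave on [0,∞). -/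
theorem stmt10 (σ2 hI hE gE hJ lam β μ p : ℝ)
    (hσ : 0 < σ2) (hhI : 0 < hI) (hhE : 0 < hE) (hgE : 0 < gE) (hhJ : 0 < hJ)
    (hlam : 0 ≤ lam) (hβ : 0 ≤ β) (hμ : 0 ≤ μ)
    (hp : 0 ≤ p) :
    ConcaveOn ℝ (Set.Ici (0 : ℝ)) (fun q => L σ2 hI hE gE hJ lam β μ p q) := by
  refine ⟨convex_Ici 0, fun x hx y hy a b ha hb hab => ?_⟩
  rw [Set.mem_Ici] at hx hy
  have hconv := (convexOn_log_one_add_div (mul_nonneg hp hhE.le)).2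
    (show σ2 + x * gE ∈ Set.Ioi 0 by rw [Set.mem_Ioi]; positivity)
    (show σ2 + y * gE ∈ Set.Ioi 0 by rw [Set.mem_Ioi]; positivity) ha hb hab
  have hlogb := div_le_div_of_nonneg_right hconv (Real.log_pos one_lt_two).le
  obtain rfl : b = 1 - a := by linarith
  have harg : a * (σ2 + x * gE) + (1 - a) * (σ2 + y * gE)
      = σ2 + (a * x + (1 - a) * y) * gE := by ring
  simp only [smul_eq_mul, harg, add_div, mul_div_assoc a, mul_div_assoc (1 - a)] at hlogb
  simp only [L, smul_eq_mul, Real.logb]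
  linarith
end

section
/- (Proposition 1, Case I, p-part) Suppose f1(0, q̄) ≤ 0, where p̄, q̄ > 0 are peak powers with q̄ ≥ A and A := max(0, σ²·(hE − hI)/(hI·gE)). Then for every (p, q) with 0 ≤ p ≤ p̄ and A ≤ q ≤ q̄, one has L(p, q) ≤ L(0, q); in particular, p = 0 maximizes L over the box [0, p̄] × [A, q̄] in the p-coordinate. -/
/-- For `0 ≤ b ≤ a`, the logarithmic gain `log (1 + p a) - log (1 + p b)` is at most its
linearization at `p = 0`. -/
theorem log_one_add_mul_sub_le {a b p : ℝ} (hb : 0 ≤ b) (hba : b ≤ a) (hp : 0 ≤ p) :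
    Real.log (1 + p * a) - Real.log (1 + p * b) ≤ p * (a - b) := by
  have hpb : 0 < 1 + p * b := by positivity
  have hpa : 0 < 1 + p * a := by
    have := mul_le_mul_of_nonneg_left hba hp
    linarith
  rw [← Real.log_div hpa.ne' hpb.ne']
  calc Real.log ((1 + p * a) / (1 + p * b)) ≤ (1 + p * a) / (1 + p * b) - 1 :=
        Real.log_le_sub_one_of_pos (div_pos hpa hpb)
    _ = p * (a - b) / (1 + p * b) := by field_simp; ring
    _ ≤ p * (a - b) :=
        div_le_self (mul_nonneg hp (sub_nonneg.2 hba)) (by linarith [mul_nonneg hp hb])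


/-- Proposition 1, Case I, p-part: if f1(0,q̄) ≤ 0 then p = 0
maximizes L in the p-coordinate over the box [0,p̄] × [A,q̄]. -/
theorem stmt11 (σ2 hI hE gE hJ lam β μ pbar qbar : ℝ)
    (hσ : 0 < σ2) (hhI : 0 < hI) (hhE : 0 < hE) (hgE : 0 < gE) (hhJ : 0 < hJ)
    (hlam : 0 ≤ lam) (hβ : 0 ≤ β) (hμ : 0 ≤ μ)
    (hpbar : 0 < pbar) (hqbar : 0 < qbar)
    (hqbarA : qbar ≥ max 0 (σ2 * (hE - hI) / (hI * gE)))
    (hcase : f1 σ2 hI hE gE hJ lam β μ 0 qbar ≤ 0) :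
    ∀ p q : ℝ, 0 ≤ p → p ≤ pbar → max 0 (σ2 * (hE - hI) / (hI * gE)) ≤ q → q ≤ qbar →
      L σ2 hI hE gE hJ lam β μ p q ≤ L σ2 hI hE gE hJ lam β μ 0 q := by
  intro p q hp _ hAq hq
  have hlog : 0 < Real.log 2 := Real.log_pos one_lt_two
  have hq0 : 0 ≤ q := (le_max_left _ _).trans hAq
  have hA : σ2 * (hE - hI) ≤ q * (hI * gE) :=
    (div_le_iff₀ (mul_pos hhI hgE)).1 ((le_max_right _ _).trans hAq)
  have hD : 0 < σ2 + q * gE := by positivity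
  have hba : hE / (σ2 + q * gE) ≤ hI / σ2 := by
    rw [div_le_div_iff₀ hD hσ]
    linarith
  have hgain := div_le_div_of_nonneg_right
    (log_one_add_mul_sub_le (by positivity) hba hp) hlog.le
  have hmono : hE / (Real.log 2 * (σ2 + qbar * gE)) ≤ hE / (Real.log 2 * (σ2 + q * gE)) := by
    gcongr
  have hslope : (hI / σ2 - hE / (σ2 + q * gE)) / Real.log 2 - lam + β * hJ + μ * hE ≤ 0 := by
    have heq : (hI / σ2 - hE / (σ2 + q * gE)) / Real.log 2
        = hI / (Real.log 2 * σ2) - hE / (Real.log 2 * (σ2 + q * gE)) := by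
      rw [sub_div, div_div, div_div, mul_comm σ2, mul_comm (σ2 + q * gE)]
    simp only [f1, zero_mul, add_zero] at hcase
    linarith
  have hfinal := mul_nonpos_of_nonneg_of_nonpos hp hslope
  simp only [L, Real.logb, zero_mul, zero_div, add_zero, zero_add, mul_zero, Real.log_one,
    mul_div_assoc p]
  rw [sub_div, mul_div_assoc p] at hgain
  linarith
end

section
/- (Proposition 1, Case I) Suppose f1(0, q̄) ≤ 0, where p̄, q̄ > 0 are peak powers with q̄ ≥ A and A := max(0, σ²·(hE − hI)/(hI·gE)). Then the maximum of L over the box [0, p̄] × [A, q̄] is attained at (0, A) if μ·gE − β < 0 and at (0, q̄) if μ·gE − β ≥ 0; i.e., for all (p, q) in the box, L(p, q) ≤ L(0, A) in the first case and L(p, q) ≤ L(0, q̄) in the second. -/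
theorem logb_two_sub_logb_two_le {x y : ℝ} (hy : 0 ≤ y) (hyx : y ≤ x) :
    Real.logb 2 (1 + x) - Real.logb 2 (1 + y) ≤ (x - y) / Real.log 2 := by
  have hy' : 0 < 1 + y := by linarith
  have hx' : 0 < 1 + x := by linarith
  have hlog := Real.log_le_sub_one_of_pos (div_pos hx' hy')
  rw [Real.log_div hx'.ne' hy'.ne'] at hlog
  have hdiv : (1 + x) / (1 + y) - 1 ≤ x - y := by
    rw [div_sub_one hy'.ne', div_le_iff₀ hy']
    nlinarith
  rw [Real.logb, Real.logb, ← sub_div]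
  exact div_le_div_of_nonneg_right (hlog.trans hdiv) (Real.log_pos one_lt_two).le

theorem L_zero_left (σ2 hI hE gE hJ lam β μ q : ℝ) :
    L σ2 hI hE gE hJ lam β μ 0 q = q * (μ * gE - β) := by
  simp only [L, zero_mul, zero_div, add_zero, Real.logb_one]
  ring

theorem f1_zero_left_mono {σ2 hI hE gE hJ lam β μ q r : ℝ} (hσ : 0 < σ2) (hhE : 0 ≤ hE)
    (hgE : 0 ≤ gE) (hq : 0 ≤ q) (hqr : q ≤ r) :
    f1 σ2 hI hE gE hJ lam β μ 0 q ≤ f1 σ2 hI hE gE hJ lam β μ 0 r := by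
  have hlog : 0 < Real.log 2 := Real.log_pos one_lt_two
  have : 0 < σ2 + q * gE := by positivity
  simp only [f1, zero_mul, add_zero]
  gcongr

theorem L_le_L_zero_left_add {σ2 hI hE gE hJ lam β μ p q : ℝ} (hσ : 0 < σ2) (hhE : 0 ≤ hE)
    (hgE : 0 ≤ gE) (hp : 0 ≤ p) (hq : 0 ≤ q) (hsnr : σ2 * hE ≤ (σ2 + q * gE) * hI) :
    L σ2 hI hE gE hJ lam β μ p q ≤
      L σ2 hI hE gE hJ lam β μ 0 q + p * f1 σ2 hI hE gE hJ lam β μ 0 q := by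
  have hs : 0 < σ2 + q * gE := by positivity
  have hyx : p * hE / (σ2 + q * gE) ≤ p * hI / σ2 := by
    rw [div_le_div_iff₀ hs hσ]
    nlinarith [mul_le_mul_of_nonneg_left hsnr hp]
  have hlog := logb_two_sub_logb_two_le (by positivity) hyx
  have heq : (p * hI / σ2 - p * hE / (σ2 + q * gE)) / Real.log 2 =
      p * (hI / (Real.log 2 * σ2) - hE / (Real.log 2 * (σ2 + q * gE))) := by
    have := (Real.log_pos one_lt_two).ne'
    field_simp
  rw [heq] at hlog
  rw [L_zero_left]
  simp only [L, f1, zero_mul, add_zero]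
  linarith

/-- Proposition 1, Case I: if f1(0,q̄) ≤ 0 then the maximum of L over
[0,p̄] × [A,q̄] is attained at (0,A) if μ·gE − β < 0 and at (0,q̄) if μ·gE − β ≥ 0. -/
theorem stmt12 (σ2 hI hE gE hJ lam β μ pbar qbar : ℝ)
    (hσ : 0 < σ2) (hhI : 0 < hI) (hhE : 0 < hE) (hgE : 0 < gE) (hhJ : 0 < hJ)
    (hlam : 0 ≤ lam) (hβ : 0 ≤ β) (hμ : 0 ≤ μ)
    (hpbar : 0 < pbar) (hqbar : 0 < qbar)
    (hqbarA : qbar ≥ max 0 (σ2 * (hE - hI) / (hI * gE)))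
    (hcase : f1 σ2 hI hE gE hJ lam β μ 0 qbar ≤ 0) :
    (μ * gE - β < 0 →
      ∀ p q : ℝ, 0 ≤ p → p ≤ pbar → max 0 (σ2 * (hE - hI) / (hI * gE)) ≤ q → q ≤ qbar →
        L σ2 hI hE gE hJ lam β μ p q ≤
          L σ2 hI hE gE hJ lam β μ 0 (max 0 (σ2 * (hE - hI) / (hI * gE)))) ∧
    (μ * gE - β ≥ 0 →
      ∀ p q : ℝ, 0 ≤ p → p ≤ pbar → max 0 (σ2 * (hE - hI) / (hI * gE)) ≤ q → q ≤ qbar →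
        L σ2 hI hE gE hJ lam β μ p q ≤ L σ2 hI hE gE hJ lam β μ 0 qbar) := by
  have key : ∀ p q : ℝ, 0 ≤ p → max 0 (σ2 * (hE - hI) / (hI * gE)) ≤ q → q ≤ qbar →
      L σ2 hI hE gE hJ lam β μ p q ≤ q * (μ * gE - β) := by
    intro p q hp hAq hqq
    have hq : 0 ≤ q := (le_max_left _ _).trans hAq
    have hsnr := (le_max_right _ _).trans hAq
    rw [div_le_iff₀ (mul_pos hhI hgE)] at hsnr
    have hL := L_le_L_zero_left_add (hJ := hJ) (lam := lam) (β := β) (μ := μ) hσ hhE.le hgE.le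
      hp hq (by linarith : σ2 * hE ≤ (σ2 + q * gE) * hI)
    have hf := (f1_zero_left_mono hσ hhE.le hgE.le hq hqq).trans hcase
    rw [L_zero_left] at hL
    linarith [mul_nonpos_of_nonneg_of_nonpos hp hf]
  simp only [L_zero_left]
  exact ⟨fun hneg p q hp _ hAq hqq =>
      (key p q hp hAq hqq).trans (mul_le_mul_of_nonpos_right hAq hneg.le),
    fun hnonneg p q hp _ hAq hqq =>
      (key p q hp hAq hqq).trans (mul_le_mul_of_nonneg_right hqq hnonneg)⟩
end

section
/- (Proposition 1, Case II-i) Suppose f1(p̄, A) ≥ 0, where p̄, q̄ > 0 are peak powers with q̄ ≥ A and A := max(0, σ²·(hE − hI)/(hI·gE)). Then for every (p, q) with 0 ≤ p ≤ p̄ and A ≤ q ≤ q̄, one has L(p, q) ≤ L(p̄, q); i.e., p = p̄ maximizes L over the box [0, p̄] × [A, q̄] in the p-coordinate. -/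
theorem hasDerivAt_L {σ2 hI hE gE : ℝ} (hJ lam β μ : ℝ) {p q : ℝ}
    (hσ : 0 < σ2) (hhI : 0 < hI) (hhE : 0 < hE) (hgE : 0 < gE) (hp : 0 ≤ p) (hq : 0 ≤ q) :
    HasDerivAt (fun x => L σ2 hI hE gE hJ lam β μ x q) (f1 σ2 hI hE gE hJ lam β μ p q) p := by
  have hs : 0 < σ2 + q * gE := by positivity
  have hlog : 0 < Real.log 2 := Real.log_pos one_lt_two
  have hd : ∀ h s : ℝ, 0 < h → 0 < s →
      HasDerivAt (fun x => Real.logb 2 (1 + x * h / s)) (h / (Real.log 2 * (s + p * h))) p := by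
    intro h s hh hs
    have hpos : 0 < 1 + p * h / s := by positivity
    have := (((((hasDerivAt_id p).mul_const h).div_const s).const_add 1).log
      hpos.ne').div_const (Real.log 2)
    refine this.congr_deriv ?_
    have : 0 < s + p * h := by positivity
    simp only [id]
    field_simp
  have hlin := (((hasDerivAt_id p).mul_const hJ).sub_const q).const_mul β
  have hlin' := (((hasDerivAt_id p).mul_const hE).add_const (q * gE)).const_mul μ
  have hL := ((((hd hI σ2 hhI hσ).sub (hd hE _ hhE hs)).sub
    ((hasDerivAt_id p).const_mul lam)).add hlin).add hlin'
  refine hL.congr_deriv ?_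
  simp only [f1]
  ring

/-- On the region `σ² hE ≤ (σ² + q gE) hI`, `f1` is antitone in `p` and monotone in `q`. -/
theorem f1_le_f1 {σ2 hI hE gE : ℝ} (hJ lam β μ : ℝ) {p p' q q' : ℝ}
    (hσ : 0 < σ2) (hhI : 0 < hI) (hhE : 0 < hE) (hgE : 0 < gE)
    (hp : 0 ≤ p) (hpp' : p ≤ p') (hq : 0 ≤ q) (hqq' : q ≤ q')
    (h : σ2 * hE ≤ (σ2 + q * gE) * hI) :
    f1 σ2 hI hE gE hJ lam β μ p' q ≤ f1 σ2 hI hE gE hJ lam β μ p q' := by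
  have hlog : 0 < Real.log 2 := Real.log_pos one_lt_two
  have hp' := hp.trans hpp'
  have hs : 0 < σ2 + q * gE := by positivity
  have hmono : hE / (Real.log 2 * (σ2 + q' * gE + p * hE)) ≤
      hE / (Real.log 2 * (σ2 + q * gE + p * hE)) := by
    gcongr
  have hdiff : ∀ x : ℝ, 0 ≤ x → hI / (Real.log 2 * (σ2 + x * hI)) -
      hE / (Real.log 2 * (σ2 + q * gE + x * hE)) =
      ((σ2 + q * gE) * hI - σ2 * hE) /
        (Real.log 2 * ((σ2 + x * hI) * (σ2 + q * gE + x * hE))) := by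
    intro x hx
    have h1 : 0 < σ2 + x * hI := by positivity
    have h2 : 0 < σ2 + q * gE + x * hE := by positivity
    field_simp
    ring
  have hanti : ((σ2 + q * gE) * hI - σ2 * hE) /
        (Real.log 2 * ((σ2 + p' * hI) * (σ2 + q * gE + p' * hE))) ≤
      ((σ2 + q * gE) * hI - σ2 * hE) /
        (Real.log 2 * ((σ2 + p * hI) * (σ2 + q * gE + p * hE))) := by
    have := sub_nonneg.mpr h
    gcongr
  rw [← hdiff p hp, ← hdiff p' hp'] at hanti
  unfold f1
  linarith

/-- Proposition 1, Case II-i: if f1(p̄,A) ≥ 0 then p = p̄ maximizes L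
in the p-coordinate over the box [0,p̄] × [A,q̄]. -/
theorem stmt13 (σ2 hI hE gE hJ lam β μ pbar qbar : ℝ)
    (hσ : 0 < σ2) (hhI : 0 < hI) (hhE : 0 < hE) (hgE : 0 < gE) (hhJ : 0 < hJ)
    (hlam : 0 ≤ lam) (hβ : 0 ≤ β) (hμ : 0 ≤ μ)
    (hpbar : 0 < pbar) (hqbar : 0 < qbar)
    (hqbarA : qbar ≥ max 0 (σ2 * (hE - hI) / (hI * gE)))
    (hcase : f1 σ2 hI hE gE hJ lam β μ pbar (max 0 (σ2 * (hE - hI) / (hI * gE))) ≥ 0) :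
    ∀ p q : ℝ, 0 ≤ p → p ≤ pbar → max 0 (σ2 * (hE - hI) / (hI * gE)) ≤ q → q ≤ qbar →
      L σ2 hI hE gE hJ lam β μ p q ≤ L σ2 hI hE gE hJ lam β μ pbar q := by
  intro p q hp hpp hAq _
  set A := max 0 (σ2 * (hE - hI) / (hI * gE)) with hA
  have hA0 : 0 ≤ A := le_max_left _ _
  have hq : 0 ≤ q := hA0.trans hAq
  have hgap : σ2 * hE ≤ (σ2 + A * gE) * hI := by
    have := (div_le_iff₀ (mul_pos hhI hgE)).mp (le_max_right 0 (σ2 * (hE - hI) / (hI * gE)))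
    rw [← hA] at this
    linarith
  have hderiv : ∀ x ∈ Set.Icc 0 pbar, HasDerivAt (fun x => L σ2 hI hE gE hJ lam β μ x q)
      (f1 σ2 hI hE gE hJ lam β μ x q) x :=
    fun x hx => hasDerivAt_L hJ lam β μ hσ hhI hhE hgE hx.1 hq
  have hmono : MonotoneOn (fun x => L σ2 hI hE gE hJ lam β μ x q) (Set.Icc 0 pbar) := by
    refine monotoneOn_of_deriv_nonneg (convex_Icc 0 pbar)
      (fun x hx => (hderiv x hx).continuousAt.continuousWithinAt)
      (fun x hx => (hderiv x (interior_subset hx)).differentiableAt.differentiableWithinAt)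
      fun x hx => ?_
    have hx' := interior_subset hx
    rw [(hderiv x hx').deriv]
    exact hcase.trans (f1_le_f1 hJ lam β μ hσ hhI hhE hgE hx'.1 hx'.2 hA0 hAq hgap)
  exact hmono ⟨hp, hpp⟩ ⟨hpbar.le, le_rfl⟩ hpp
end

section
/- (Ordering of the roots χ(f1(0,·)) and χ(f1(p̄,·))) Let p̄ > 0 and suppose q₁, q₂ ≥ A satisfy f1(0, q₁) = 0 and f1(p̄, q₂) = 0, where A := max(0, σ²·(hE − hI)/(hI·gE)). Then q₁ ≤ q₂; i.e., the zero of q ↦ f1(p̄, q) is at least as large as the zero of q ↦ f1(0, q). -/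
/-- If `e / x ≤ a / s`, raising `x` by `p * e` and `s` by `p * a` shrinks the gap
`a / s - e / x`. -/
theorem div_sub_div_add_mul_le {a e s x p : ℝ} (ha : 0 < a) (he : 0 < e) (hs : 0 < s)
    (hx : 0 < x) (hp : 0 ≤ p) (h : e * s ≤ a * x) :
    a / (s + p * a) - e / (x + p * e) ≤ a / s - e / x := by
  have hs' : 0 < s + p * a := by positivity
  have hx' : 0 < x + p * e := by positivity
  have h₁ : e / x ≤ a / s := by rwa [div_le_div_iff₀ hx hs]
  have h₂ : e / (x + p * e) ≤ a / (s + p * a) := by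
    rw [div_le_div_iff₀ hx' hs']
    linarith
  have ha' : a / s - a / (s + p * a) = p * (a / s * (a / (s + p * a))) := by
    field_simp
    ring
  have he' : e / x - e / (x + p * e) = p * (e / x * (e / (x + p * e))) := by
    field_simp
    ring
  have hmul : p * (e / x * (e / (x + p * e))) ≤ p * (a / s * (a / (s + p * a))) := by gcongr
  linarith


/-- ordering of the roots: if q₁, q₂ ≥ A with f1(0,q₁) = 0 and
f1(p̄,q₂) = 0, then q₁ ≤ q₂, where A := max(0, σ²(hE−hI)/(hI·gE)). -/
theorem stmt16 (σ2 hI hE gE hJ lam β μ pbar q₁ q₂ : ℝ)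
    (hσ : 0 < σ2) (hhI : 0 < hI) (hhE : 0 < hE) (hgE : 0 < gE) (hhJ : 0 < hJ)
    (hlam : 0 ≤ lam) (hβ : 0 ≤ β) (hμ : 0 ≤ μ)
    (hpbar : 0 < pbar)
    (hq₁ : q₁ ≥ max 0 (σ2 * (hE - hI) / (hI * gE)))
    (hq₂ : q₂ ≥ max 0 (σ2 * (hE - hI) / (hI * gE)))
    (hroot₁ : f1 σ2 hI hE gE hJ lam β μ 0 q₁ = 0)
    (hroot₂ : f1 σ2 hI hE gE hJ lam β μ pbar q₂ = 0) :
    q₁ ≤ q₂ := by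
  have hq₁_nonneg : 0 ≤ q₁ := (le_max_left _ _).trans hq₁
  have hq₂_nonneg : 0 ≤ q₂ := (le_max_left _ _).trans hq₂
  have hratio : hE * σ2 ≤ hI * (σ2 + q₂ * gE) := by
    have h := (le_max_right _ _).trans hq₂
    rw [div_le_iff₀ (by positivity)] at h
    linarith
  have hlog : 0 < Real.log 2 := Real.log_pos one_lt_two
  have hgap := div_sub_div_add_mul_le hhI hhE hσ (by positivity) hpbar.le hratio
  simp only [f1, zero_mul, add_zero, div_mul_eq_div_div_swap] at hroot₁ hroot₂
  by_contra! hlt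
  have hstrict : hE / (σ2 + q₁ * gE) < hE / (σ2 + q₂ * gE) := by gcongr
  have hscaled := div_lt_div_of_pos_right (hgap.trans_lt (sub_lt_sub_left hstrict _)) hlog
  rw [sub_div, sub_div] at hscaled
  linarith
end

section
/- If f1(0, q̄) ≤ 0 and q̄ ≥ A, then for all p ∈ [0, p̄] and q ∈ [A, q̄], f1(p, q) ≤ 0, where A := max(0, σ²·(hE − hI)/(hI·gE)); and symmetrically, if f1(p̄, A) ≥ 0, then for all p ∈ [0, p̄] and q ∈ [A, q̄], f1(p, q) ≥ 0. -/
theorem f1_mono_right {σ2 hI hE gE hJ lam β μ p q q' : ℝ}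
    (hσ : 0 < σ2) (hhE : 0 < hE) (hgE : 0 < gE) (hp : 0 ≤ p) (hq : 0 ≤ q) (hqq' : q ≤ q') :
    f1 σ2 hI hE gE hJ lam β μ p q ≤ f1 σ2 hI hE gE hJ lam β μ p q' := by
  have hL : 0 < Real.log 2 := Real.log_pos (by norm_num)
  unfold f1
  gcongr

theorem f1_anti_left {σ2 hI hE gE hJ lam β μ p p' q : ℝ}
    (hσ : 0 < σ2) (hhI : 0 < hI) (hhE : 0 < hE) (hgE : 0 < gE) (hp : 0 ≤ p) (hpp' : p ≤ p')
    (hq : 0 ≤ q) (hqA : σ2 * (hE - hI) / (hI * gE) ≤ q) :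
    f1 σ2 hI hE gE hJ lam β μ p' q ≤ f1 σ2 hI hE gE hJ lam β μ p q := by
  have hL : 0 < Real.log 2 := Real.log_pos (by norm_num)
  have hp' : 0 ≤ p' := hp.trans hpp'
  rw [div_le_iff₀ (by positivity)] at hqA
  have hratio : ∀ r : ℝ, hE * (σ2 + r * hI) ≤ hI * (σ2 + q * gE + r * hE) := fun r => by
    nlinarith
  have hprod := mul_le_mul (hratio p) (hratio p') (by positivity) (by positivity)
  have hquot : hE ^ 2 / ((σ2 + q * gE + p * hE) * (σ2 + q * gE + p' * hE)) ≤
      hI ^ 2 / ((σ2 + p * hI) * (σ2 + p' * hI)) := by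
    rw [div_le_div_iff₀ (by positivity) (by positivity)]
    linarith
  have hscaled := mul_le_mul_of_nonneg_left hquot
    (div_nonneg (sub_nonneg.mpr hpp') hL.le)
  have hdiffI : hI / (Real.log 2 * (σ2 + p * hI)) - hI / (Real.log 2 * (σ2 + p' * hI)) =
      (p' - p) / Real.log 2 * (hI ^ 2 / ((σ2 + p * hI) * (σ2 + p' * hI))) := by
    have h : σ2 + p * hI ≠ 0 := by positivity
    have h' : σ2 + p' * hI ≠ 0 := by positivity
    field_simp
    ring
  have hdiffE : hE / (Real.log 2 * (σ2 + q * gE + p * hE)) -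
        hE / (Real.log 2 * (σ2 + q * gE + p' * hE)) =
      (p' - p) / Real.log 2 *
        (hE ^ 2 / ((σ2 + q * gE + p * hE) * (σ2 + q * gE + p' * hE))) := by
    have h : σ2 + q * gE + p * hE ≠ 0 := by positivity
    have h' : σ2 + q * gE + p' * hE ≠ 0 := by positivity
    field_simp
    ring
  unfold f1
  linarith

/-- if f1(0,q̄) ≤ 0 and q̄ ≥ A then f1 ≤ 0 on [0,p̄] × [A,q̄];
symmetrically, if f1(p̄,A) ≥ 0 then f1 ≥ 0 on [0,p̄] × [A,q̄], where
A := max(0, σ²(hE−hI)/(hI·gE)). -/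
theorem stmt17 (σ2 hI hE gE hJ lam β μ pbar qbar : ℝ)
    (hσ : 0 < σ2) (hhI : 0 < hI) (hhE : 0 < hE) (hgE : 0 < gE) (hhJ : 0 < hJ)
    (hlam : 0 ≤ lam) (hβ : 0 ≤ β) (hμ : 0 ≤ μ)
    (hpbar : 0 < pbar) (hqbar : 0 < qbar)
    (hqbarA : qbar ≥ max 0 (σ2 * (hE - hI) / (hI * gE))) :
    (f1 σ2 hI hE gE hJ lam β μ 0 qbar ≤ 0 →
      ∀ p q : ℝ, 0 ≤ p → p ≤ pbar → max 0 (σ2 * (hE - hI) / (hI * gE)) ≤ q → q ≤ qbar →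
        f1 σ2 hI hE gE hJ lam β μ p q ≤ 0) ∧
    (0 ≤ f1 σ2 hI hE gE hJ lam β μ pbar (max 0 (σ2 * (hE - hI) / (hI * gE))) →
      ∀ p q : ℝ, 0 ≤ p → p ≤ pbar → max 0 (σ2 * (hE - hI) / (hI * gE)) ≤ q → q ≤ qbar →
        0 ≤ f1 σ2 hI hE gE hJ lam β μ p q) := by
  refine ⟨fun h p q hp _ hAq hq => ?_, fun h p q hp hp' hAq _ => ?_⟩
  · have hq0 : 0 ≤ q := (le_max_left _ _).trans hAq
    calc f1 σ2 hI hE gE hJ lam β μ p q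
        ≤ f1 σ2 hI hE gE hJ lam β μ 0 q :=
          f1_anti_left hσ hhI hhE hgE le_rfl hp hq0 ((le_max_right _ _).trans hAq)
      _ ≤ f1 σ2 hI hE gE hJ lam β μ 0 qbar := f1_mono_right hσ hhE hgE le_rfl hq0 hq
      _ ≤ 0 := h
  · exact (h.trans (f1_anti_left hσ hhI hhE hgE hp hp' (le_max_left _ _) (le_max_right _ _))).trans
      (f1_mono_right hσ hhE hgE hp (le_max_left _ _) hAq)
end
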